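/- Consider the quantum triangle network with shared randomness: there are finite-dimensional Hilbert spaces and three bipartite density matrices τ_{AB} (shared between Alice and Bob), τ_{BC} (shared between Bob and Charlie), τ_{CA} (shared between Charlie and Alice), a finite set Λ with a probability distribution q(λ) of shared randomness, and for each λ ∈ Λ and each input, ±1-outcome POVMs: {M^{A,λ}_{x,a}}_a for Alice acting on her two subsystems (her halves of τ_{AB} and τ_{CA}) for x ∈ {0,1}, {M^{B,λ}_{y,b}}_b for Bob on his halves of τ_{AB} and τ_{BC} for y ∈ {0,1,2}, and {M^{C,λ}_{z,c}}_c for Charlie on his halves of τ_{BC} and τ_{CA} for z ∈ {0,1}. Let P(a,b,c|x,y,z) = Σ_λ q(λ)·Tr[(τ_{AB}⊗τ_{BC}⊗τ_{CA})·(M^{A,λ}_{x,a}⊗M^{B,λ}_{y,b}⊗M^{C,λ}_{z,c})] (with operators reordered to act on the appropriate tensor factors). If E[C₁] = 0 and P(C₁=1|z=1) > 0, then I_Bell^{C₁=1} + 4·I_same ≤ 10, where I_Bell^{C₁=1} is the CHSH expression between Alice and Bob conditioned on Charlie's outcome C₁ = 1 and I_same := E[A₀B₂] + E[B₂C₀].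 -/

import Mathlib

open Matrix
open scoped Kronecker BigOperators ComplexOrder

/-- The set of outcomes `{−1, +1}`. -/
def pm : Finset ℤ := {-1, 1}

/-- Reindexing that aligns the measurement-side ordering of tensor factors
`(A₁ × A₂) × (B₁ × B₂) × (C₁ × C₂)` (Alice's, Bob's, Charlie's subsystems)
with the state-side ordering `(A₁ × B₁) × (B₂ × C₁) × (C₂ × A₂)`
(the subsystems of `τ_AB ⊗ τ_BC ⊗ τ_CA` in the triangle network). -/
def triReindex {α₁ α₂ β₁ β₂ γ₁ γ₂ : Type*} :
    ((α₁ × α₂) × (β₁ × β₂)) × (γ₁ × γ₂) → ((α₁ × β₁) × (β₂ × γ₁)) × (γ₂ × α₂) :=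
  fun t => (((t.1.1.1, t.1.2.1), (t.1.2.2, t.2.1)), (t.2.2, t.1.1.2))

/-- The conditional correlator `⟨A_x B_y⟩_{C₁=1}` computed from the conditional
distribution `P(a,b|x,y, C₁=1, z=1)`. -/
noncomputable def condCorr (P : ℤ → ℤ → ℤ → Fin 2 → Fin 3 → Fin 2 → ℝ)
    (x : Fin 2) (y : Fin 3) : ℝ :=
  (∑ a ∈ pm, ∑ b ∈ pm, (a : ℝ) * (b : ℝ) * P a b 1 x y 1) /
    (∑ a ∈ pm, ∑ b ∈ pm, P a b 1 x y 1)

/-- The consistency score `I_same = E[A₀B₂] + E[B₂C₀]`. -/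
noncomputable def Isame (P : ℤ → ℤ → ℤ → Fin 2 → Fin 3 → Fin 2 → ℝ) : ℝ :=
  (∑ a ∈ pm, ∑ b ∈ pm, ∑ c ∈ pm, (a : ℝ) * (b : ℝ) * P a b c 0 2 0) +
  (∑ a ∈ pm, ∑ b ∈ pm, ∑ c ∈ pm, (b : ℝ) * (c : ℝ) * P a b c 0 2 0)

section PartialTrace

variable {m n : Type*}

/-- The partial trace over the second tensor factor. -/
def ptraceRight [Fintype n] (M : Matrix (m × n) (m × n) ℂ) : Matrix m m ℂ :=
  ∑ k, M.submatrix (fun i => (i, k)) (fun i => (i, k))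

/-- The partial trace over the first tensor factor. -/
def ptraceLeft [Fintype m] (M : Matrix (m × n) (m × n) ℂ) : Matrix n n ℂ :=
  ∑ k, M.submatrix (fun i => (k, i)) (fun i => (k, i))

lemma ptraceRight_apply [Fintype n] (M : Matrix (m × n) (m × n) ℂ) (i j : m) :
    ptraceRight M i j = ∑ k, M (i, k) (j, k) := by
  simp [ptraceRight, Matrix.sum_apply]

lemma ptraceLeft_apply [Fintype m] (M : Matrix (m × n) (m × n) ℂ) (i j : n) :
    ptraceLeft M i j = ∑ k, M (k, i) (k, j) := by
  simp [ptraceLeft, Matrix.sum_apply]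

lemma trace_ptraceRight [Fintype m] [Fintype n] (M : Matrix (m × n) (m × n) ℂ) :
    (ptraceRight M).trace = M.trace := by
  simp [Matrix.trace, ptraceRight_apply, Fintype.sum_prod_type]

lemma trace_ptraceLeft [Fintype m] [Fintype n] (M : Matrix (m × n) (m × n) ℂ) :
    (ptraceLeft M).trace = M.trace := by
  simp [Matrix.trace, ptraceLeft_apply, Fintype.sum_prod_type_right]

lemma Matrix.PosSemidef.ptraceRight [Fintype n] {M : Matrix (m × n) (m × n) ℂ} (hM : M.PosSemidef) :
    (ptraceRight M).PosSemidef :=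
  Matrix.posSemidef_sum _ fun _ _ => hM.submatrix _

lemma Matrix.PosSemidef.ptraceLeft [Fintype m] {M : Matrix (m × n) (m × n) ℂ} (hM : M.PosSemidef) :
    (ptraceLeft M).PosSemidef :=
  Matrix.posSemidef_sum _ fun _ _ => hM.submatrix _

lemma ptraceRight_kronecker [Fintype n] (A : Matrix m m ℂ) (B : Matrix n n ℂ) :
    ptraceRight (A ⊗ₖ B) = B.trace • A := by
  ext i j
  simp [ptraceRight_apply, Matrix.trace, ← Finset.mul_sum, mul_comm]

lemma ptraceLeft_kronecker [Fintype m] (A : Matrix m m ℂ) (B : Matrix n n ℂ) :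
    ptraceLeft (A ⊗ₖ B) = A.trace • B := by
  ext i j
  simp [ptraceLeft_apply, Matrix.trace, Finset.sum_mul]

lemma ptraceLeft_marginals [Fintype m] [Fintype n] {M : Matrix (m × n) (m × n) ℂ} (hM : M.trace = 1) :
    ptraceLeft (ptraceRight M ⊗ₖ ptraceLeft M) = ptraceLeft M := by
  rw [ptraceLeft_kronecker, trace_ptraceRight, hM, one_smul]

lemma ptraceRight_marginals [Fintype m] [Fintype n] {M : Matrix (m × n) (m × n) ℂ} (hM : M.trace = 1) :
    ptraceRight (ptraceRight M ⊗ₖ ptraceLeft M) = ptraceRight M := by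
  rw [ptraceRight_kronecker, trace_ptraceLeft, hM, one_smul]

lemma trace_mul_kronecker_one [Fintype m] [Fintype n] [DecidableEq n] (S : Matrix (m × n) (m × n) ℂ)
    (W : Matrix m m ℂ) : (S * (W ⊗ₖ 1)).trace = (ptraceRight S * W).trace := by
  simp only [Matrix.trace, Matrix.diag_apply, Matrix.mul_apply, Fintype.sum_prod_type,
    Matrix.kroneckerMap_apply, Matrix.one_apply, ptraceRight_apply, mul_ite, mul_one, mul_zero,
    Finset.sum_ite_eq', Finset.mem_univ, if_true, Finset.sum_mul]
  exact Finset.sum_congr rfl fun _ _ => Finset.sum_comm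

lemma trace_mul_one_kronecker [Fintype m] [Fintype n] [DecidableEq m] (S : Matrix (m × n) (m × n) ℂ)
    (W : Matrix n n ℂ) : (S * (1 ⊗ₖ W)).trace = (ptraceLeft S * W).trace := by
  simp only [Matrix.trace, Matrix.diag_apply, Matrix.mul_apply, Fintype.sum_prod_type_right,
    Matrix.kroneckerMap_apply, Matrix.one_apply, ptraceLeft_apply, ite_mul, one_mul, zero_mul,
    mul_ite, mul_zero, Finset.sum_ite_eq', Finset.mem_univ, if_true, Finset.sum_mul]
  exact Finset.sum_congr rfl fun _ _ => Finset.sum_comm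

lemma trace_submatrix_mul_submatrix [Fintype m] [Fintype n] (e : n ≃ m) (A B : Matrix m m ℂ) :
    (A.submatrix e e * B.submatrix e e).trace = (A * B).trace := by
  rw [Matrix.submatrix_mul_equiv]
  exact e.sum_comp fun i => (A * B) i i

/-- The trace of a product of positive semidefinite matrices is nonnegative. -/
lemma Matrix.PosSemidef.trace_mul_nonneg [Fintype m] {A B : Matrix m m ℂ}
    (hA : A.PosSemidef) (hB : B.PosSemidef) : 0 ≤ (A * B).trace := by
  classical
  obtain ⟨C, rfl⟩ : ∃ C, B = Cᴴ * C := by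
    open scoped MatrixOrder in
    exact CStarAlgebra.nonneg_iff_eq_star_mul_self.mp hB.nonneg
  rw [← Matrix.mul_assoc, Matrix.trace_mul_comm, ← Matrix.mul_assoc]
  exact (hA.mul_mul_conjTranspose_same C).trace_nonneg

end PartialTrace

section Triangle

variable {α₁ α₂ β₁ β₂ γ₁ γ₂ : Type*} [Fintype α₁] [Fintype α₂] [Fintype β₁] [Fintype β₂]
  [Fintype γ₁] [Fintype γ₂]

/-- The value of a product observable on the global state of the triangle network. -/
noncomputable def triangleTrace (τAB : Matrix (α₁ × β₁) (α₁ × β₁) ℂ)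
    (τBC : Matrix (β₂ × γ₁) (β₂ × γ₁) ℂ) (τCA : Matrix (γ₂ × α₂) (γ₂ × α₂) ℂ)
    (X : Matrix (α₁ × α₂) (α₁ × α₂) ℂ) (Y : Matrix (β₁ × β₂) (β₁ × β₂) ℂ)
    (Z : Matrix (γ₁ × γ₂) (γ₁ × γ₂) ℂ) : ℂ :=
  ((τAB ⊗ₖ τBC ⊗ₖ τCA).submatrix triReindex triReindex * (X ⊗ₖ Y ⊗ₖ Z)).trace

variable {τAB : Matrix (α₁ × β₁) (α₁ × β₁) ℂ} {τBC : Matrix (β₂ × γ₁) (β₂ × γ₁) ℂ}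
  {τCA σ : Matrix (γ₂ × α₂) (γ₂ × α₂) ℂ} {X X' : Matrix (α₁ × α₂) (α₁ × α₂) ℂ}
  {Y Y' : Matrix (β₁ × β₂) (β₁ × β₂) ℂ} {Z Z' : Matrix (γ₁ × γ₂) (γ₁ × γ₂) ℂ}

lemma triangleTrace_nonneg (hAB : τAB.PosSemidef) (hBC : τBC.PosSemidef) (hCA : τCA.PosSemidef)
    (hX : X.PosSemidef) (hY : Y.PosSemidef) (hZ : Z.PosSemidef) :
    0 ≤ triangleTrace τAB τBC τCA X Y Z := by
  classical
  exact (((hAB.kronecker hBC).kronecker hCA).submatrix _).trace_mul_nonneg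
    ((hX.kronecker hY).kronecker hZ)

lemma triangleTrace_add_left : triangleTrace τAB τBC τCA (X + X') Y Z =
    triangleTrace τAB τBC τCA X Y Z + triangleTrace τAB τBC τCA X' Y Z := by
  simp [triangleTrace, Matrix.add_kronecker, Matrix.mul_add]

lemma triangleTrace_add_mid : triangleTrace τAB τBC τCA X (Y + Y') Z =
    triangleTrace τAB τBC τCA X Y Z + triangleTrace τAB τBC τCA X Y' Z := by
  simp [triangleTrace, Matrix.add_kronecker, Matrix.kronecker_add, Matrix.mul_add]

lemma triangleTrace_add_right : triangleTrace τAB τBC τCA X Y (Z + Z') =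
    triangleTrace τAB τBC τCA X Y Z + triangleTrace τAB τBC τCA X Y Z' := by
  simp [triangleTrace, Matrix.kronecker_add, Matrix.mul_add]

/-- When Charlie is ignored, only the reduction of `τCA` to Alice's side matters. -/
lemma triangleTrace_one_right_congr [DecidableEq γ₁] [DecidableEq γ₂]
    (h : ptraceLeft τCA = ptraceLeft σ) :
    triangleTrace τAB τBC τCA X Y 1 = triangleTrace τAB τBC σ X Y 1 := by
  simp only [triangleTrace, trace_mul_kronecker_one]
  congr 2
  ext i j
  have hij := congrFun (congrFun h i.1.2) j.1.2
  simp only [ptraceLeft_apply] at hij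
  simp [ptraceRight_apply, triReindex, Fintype.sum_prod_type, ← Finset.mul_sum, hij]

/-- When Alice is ignored, only the reduction of `τCA` to Charlie's side matters. -/
lemma triangleTrace_one_left_congr [DecidableEq α₁] [DecidableEq α₂]
    (h : ptraceRight τCA = ptraceRight σ) :
    triangleTrace τAB τBC τCA 1 Y Z = triangleTrace τAB τBC σ 1 Y Z := by
  have key (ω : Matrix (γ₂ × α₂) (γ₂ × α₂) ℂ) : triangleTrace τAB τBC ω 1 Y Z =
      (ptraceLeft (((τAB ⊗ₖ τBC ⊗ₖ ω).submatrix triReindex triReindex).submatrix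
        (Equiv.prodAssoc _ _ _).symm (Equiv.prodAssoc _ _ _).symm) * (Y ⊗ₖ Z)).trace := by
    rw [triangleTrace, ← trace_mul_one_kronecker, ← Matrix.kronecker_assoc,
      Matrix.reindex_apply, trace_submatrix_mul_submatrix]
  rw [key, key]
  congr 2
  ext i j
  have hij := congrFun (congrFun h i.2.2) j.2.2
  simp only [ptraceRight_apply] at hij
  simp [ptraceLeft_apply, triReindex, Fintype.sum_prod_type, ← Finset.mul_sum, hij]

/-- Charlie and Alice are independent when they share no source. -/
lemma triangleTrace_kronecker_one_mid [DecidableEq β₁] [DecidableEq β₂]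
    (ρC : Matrix γ₂ γ₂ ℂ) (ρA : Matrix α₂ α₂ ℂ) :
    triangleTrace τAB τBC (ρC ⊗ₖ ρA) X 1 Z =
      ((ptraceRight τAB ⊗ₖ ρA) * X).trace * ((ptraceLeft τBC ⊗ₖ ρC) * Z).trace := by
  let e : (β₁ × β₂) × ((α₁ × α₂) × (γ₁ × γ₂)) ≃ ((α₁ × α₂) × (β₁ × β₂)) × (γ₁ × γ₂) :=
    ((Equiv.prodAssoc _ _ _).symm).trans ((Equiv.prodComm _ _).prodCongr (Equiv.refl _))
  have hM : (X ⊗ₖ (1 : Matrix (β₁ × β₂) (β₁ × β₂) ℂ) ⊗ₖ Z).submatrix e e = 1 ⊗ₖ (X ⊗ₖ Z) := by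
    ext i j
    simp only [e, Matrix.submatrix_apply, Matrix.kroneckerMap_apply, Equiv.trans_apply,
      Equiv.prodAssoc_symm_apply, Equiv.prodCongr_apply, Prod.map, Equiv.prodComm_apply,
      Prod.swap_prod_mk, Equiv.refl_apply]
    ring
  rw [triangleTrace, ← trace_submatrix_mul_submatrix e, hM, trace_mul_one_kronecker,
    ← Matrix.trace_kronecker, Matrix.mul_kronecker_mul]
  congr 2
  ext i j
  simp only [e, ptraceLeft_apply, ptraceRight_apply, triReindex, Fintype.sum_prod_type,
    Matrix.submatrix_apply, Matrix.kroneckerMap_apply, Equiv.trans_apply,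
    Equiv.prodAssoc_symm_apply, Equiv.prodCongr_apply, Prod.map, Equiv.prodComm_apply,
    Prod.swap_prod_mk, Equiv.refl_apply, Finset.sum_mul, Finset.mul_sum]
  rw [Finset.sum_comm]
  refine Finset.sum_congr rfl fun _ _ => Finset.sum_congr rfl fun _ _ => ?_
  ring

lemma triangleTrace_one (hAB : τAB.trace = 1) (hBC : τBC.trace = 1) (hCA : τCA.trace = 1)
    [DecidableEq α₁] [DecidableEq α₂] [DecidableEq β₁] [DecidableEq β₂]
    [DecidableEq γ₁] [DecidableEq γ₂] : triangleTrace τAB τBC τCA 1 1 1 = 1 := by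
  rw [triangleTrace_one_right_congr (ptraceLeft_marginals hCA).symm, triangleTrace_kronecker_one_mid]
  simp [Matrix.trace_kronecker, trace_ptraceRight, trace_ptraceLeft, hAB, hBC, hCA]

/-- Cutting the source between Charlie and Alice into its two marginals makes Charlie and Alice
independent, with unchanged individual marginals. -/
lemma triangleTrace_cut [DecidableEq α₁] [DecidableEq α₂] [DecidableEq β₁] [DecidableEq β₂]
    [DecidableEq γ₁] [DecidableEq γ₂]
    (hAB : τAB.trace = 1) (hBC : τBC.trace = 1) (hCA : τCA.trace = 1) :
    triangleTrace τAB τBC (ptraceRight τCA ⊗ₖ ptraceLeft τCA) X 1 Z =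
      triangleTrace τAB τBC τCA X 1 1 * triangleTrace τAB τBC τCA 1 1 Z := by
  rw [triangleTrace_one_right_congr (ptraceLeft_marginals hCA).symm,
    triangleTrace_one_left_congr (ptraceRight_marginals hCA).symm]
  simp only [triangleTrace_kronecker_one_mid]
  simp [Matrix.trace_kronecker, trace_ptraceRight, trace_ptraceLeft, hAB, hBC, hCA]

end Triangle

lemma sum_pm {M : Type*} [AddCommMonoid M] (f : ℤ → M) : ∑ a ∈ pm, f a = f (-1) + f 1 := by
  simp [pm]

/-- A no-signalling tripartite box satisfies the (unnormalised) inequality as soon as the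
consistency-game marginals for Alice–Bob and Bob–Charlie extend to a joint distribution in which
Alice and Charlie are independent. -/
lemma bell_same_bound (p : ℤ → ℤ → ℤ → Fin 2 → Fin 3 → Fin 2 → ℝ) (r : ℤ → ℤ → ℤ → ℝ)
    (hp : ∀ a ∈ pm, ∀ b ∈ pm, ∀ c ∈ pm, ∀ x y z, 0 ≤ p a b c x y z)
    (hr : ∀ a ∈ pm, ∀ b ∈ pm, ∀ c ∈ pm, 0 ≤ r a b c)
    (hA : ∀ b c x x' y z,
      p (-1) b c x y z + p 1 b c x y z = p (-1) b c x' y z + p 1 b c x' y z)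
    (hB : ∀ a c x y y' z,
      p a (-1) c x y z + p a 1 c x y z = p a (-1) c x y' z + p a 1 c x y' z)
    (hC : ∀ a b x y z z',
      p a b (-1) x y z + p a b 1 x y z = p a b (-1) x y z' + p a b 1 x y z')
    (hone : ∑ a ∈ pm, ∑ b ∈ pm, ∑ c ∈ pm, p a b c 0 2 0 = 1)
    (hrAB : ∀ a b, ∑ c ∈ pm, r a b c = ∑ c ∈ pm, p a b c 0 2 0)
    (hrBC : ∀ b c, ∑ a ∈ pm, r a b c = ∑ a ∈ pm, p a b c 0 2 0)
    (hrAC : ∀ a ∈ pm, ∀ c ∈ pm, ∑ b ∈ pm, r a b c =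
      (∑ b ∈ pm, ∑ c ∈ pm, p a b c 0 2 0) * ∑ a ∈ pm, ∑ b ∈ pm, p a b c 0 2 0) :
    2 * ((∑ a ∈ pm, ∑ b ∈ pm, (a : ℝ) * b * p a b 1 0 0 1)
        + (∑ a ∈ pm, ∑ b ∈ pm, (a : ℝ) * b * p a b 1 0 1 1)
        + (∑ a ∈ pm, ∑ b ∈ pm, (a : ℝ) * b * p a b 1 1 0 1)
        - (∑ a ∈ pm, ∑ b ∈ pm, (a : ℝ) * b * p a b 1 1 1 1))
      + 4 * Isame p ≤ 4 * (∑ a ∈ pm, ∑ b ∈ pm, p a b 1 0 0 1) + 8 := by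
  have m1 : (-1 : ℤ) ∈ pm := by simp [pm]
  have m2 : (1 : ℤ) ∈ pm := by simp [pm]
  simp only [sum_pm, Isame] at *
  push_cast
  set α := (p 1 (-1) (-1) 0 2 0 + p 1 (-1) 1 0 2 0 + (p 1 1 (-1) 0 2 0 + p 1 1 1 0 2 0)) -
    (p (-1) (-1) (-1) 0 2 0 + p (-1) (-1) 1 0 2 0 +
      (p (-1) 1 (-1) 0 2 0 + p (-1) 1 1 0 2 0))
  set γ := (p (-1) (-1) 1 0 2 0 + p (-1) 1 1 0 2 0 + (p 1 (-1) 1 0 2 0 + p 1 1 1 0 2 0)) -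
    (p (-1) (-1) (-1) 0 2 0 + p (-1) 1 (-1) 0 2 0 +
      (p 1 (-1) (-1) 0 2 0 + p 1 1 (-1) 0 2 0))
  have hpos (x y z) := And.intro
    (And.intro (And.intro (hp _ m1 _ m1 _ m1 x y z) (hp _ m1 _ m1 _ m2 x y z))
      (And.intro (hp _ m1 _ m2 _ m1 x y z) (hp _ m1 _ m2 _ m2 x y z)))
    (And.intro (And.intro (hp _ m2 _ m1 _ m1 x y z) (hp _ m2 _ m1 _ m2 x y z))
      (And.intro (hp _ m2 _ m2 _ m1 x y z) (hp _ m2 _ m2 _ m2 x y z)))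
  have hαγ : α * γ = r (-1) (-1) (-1) + r (-1) 1 (-1) - (r (-1) (-1) 1 + r (-1) 1 1)
      - (r 1 (-1) (-1) + r 1 1 (-1)) + (r 1 (-1) 1 + r 1 1 1) := by
    rw [hrAC _ m1 _ m1, hrAC _ m1 _ m2, hrAC _ m2 _ m1, hrAC _ m2 _ m2]; ring
  have hγ1 : |γ| ≤ 1 := by
    obtain ⟨⟨⟨_, _⟩, _, _⟩, ⟨_, _⟩, _, _⟩ := hpos 0 2 0
    rw [abs_le]; constructor <;> linarith
  have hαγ_le : α * γ ≤ |α| := by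
    calc α * γ ≤ |α * γ| := le_abs_self _
      _ = |α| * |γ| := abs_mul _ _
      _ ≤ |α| := mul_le_of_le_one_right (abs_nonneg _) hγ1
  have hsame : Isame p ≤ 1 + α * γ := by
    simp only [Isame, sum_pm]
    push_cast
    have := hr _ m1 _ m1 _ m1
    have := hr _ m1 _ m1 _ m2
    have := hr _ m1 _ m2 _ m1
    have := hr _ m1 _ m2 _ m2
    have := hr _ m2 _ m1 _ m1
    have := hr _ m2 _ m1 _ m2
    have := hr _ m2 _ m2 _ m1
    have := hr _ m2 _ m2 _ m2
    linarith [hrAB (-1) (-1), hrAB (-1) 1, hrAB 1 (-1), hrAB 1 1,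
      hrBC (-1) (-1), hrBC (-1) 1, hrBC 1 (-1), hrBC 1 1]
  simp only [Isame, sum_pm] at hsame
  push_cast at hsame
  have hneg : p (-1) (-1) 1 0 0 1 + p (-1) 1 1 0 0 1 ≤
      p (-1) (-1) (-1) 0 2 0 + p (-1) (-1) 1 0 2 0 +
      (p (-1) 1 (-1) 0 2 0 + p (-1) 1 1 0 2 0) := by
    obtain ⟨⟨⟨_, _⟩, _, _⟩, ⟨_, _⟩, _, _⟩ := hpos 0 0 1
    linarith [hC (-1) (-1) 0 2 0 1, hC (-1) 1 0 2 0 1, hB (-1) 1 0 0 2 1, hB (-1) (-1) 0 0 2 1]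
  have hplus : p 1 (-1) 1 0 0 1 + p 1 1 1 0 0 1 ≤
      p 1 (-1) (-1) 0 2 0 + p 1 (-1) 1 0 2 0 + (p 1 1 (-1) 0 2 0 + p 1 1 1 0 2 0) := by
    obtain ⟨⟨⟨_, _⟩, _, _⟩, ⟨_, _⟩, _, _⟩ := hpos 0 0 1
    linarith [hC 1 (-1) 0 2 0 1, hC 1 1 0 2 0 1, hB 1 1 0 0 2 1, hB 1 (-1) 0 0 2 1]
  obtain ⟨⟨⟨_, _⟩, _, _⟩, ⟨_, _⟩, _, _⟩ := hpos 0 0 1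
  obtain ⟨⟨⟨_, _⟩, _, _⟩, ⟨_, _⟩, _, _⟩ := hpos 0 1 1
  obtain ⟨⟨⟨_, _⟩, _, _⟩, ⟨_, _⟩, _, _⟩ := hpos 1 0 1
  obtain ⟨⟨⟨_, _⟩, _, _⟩, ⟨_, _⟩, _, _⟩ := hpos 1 1 1
  have b1 := hB (-1) 1 0 0 1 1
  have b2 := hB 1 1 0 0 1 1
  have b3 := hB (-1) 1 1 0 1 1
  have b4 := hB 1 1 1 0 1 1
  have a1 := hA (-1) 1 0 1 0 1
  have a2 := hA 1 1 0 1 0 1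
  have a3 := hA (-1) 1 0 1 1 1
  have a4 := hA 1 1 0 1 1 1
  rcases abs_cases α with ⟨h, -⟩ | ⟨h, -⟩ <;> rw [h] at hαγ_le <;> linarith

/-- In the quantum triangle network with shared randomness —
bipartite density matrices `τ_AB, τ_BC, τ_CA` distributed among the three
parties, shared randomness `λ` with distribution `q`, and ±1-outcome POVMs
acting on each party's two subsystems — if `E[C₁] = 0` and `P(C₁=1|z=1) > 0`,
then `I_Bell^{C₁=1} + 4·I_same ≤ 10`. -/
theorem triangle_network_inequality
    {dA₁ dA₂ dB₁ dB₂ dC₁ dC₂ : ℕ} {Λ : Type*} [Fintype Λ]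
    (q : Λ → ℝ) (hq0 : ∀ l, 0 ≤ q l) (hq1 : ∑ l, q l = 1)
    (τAB : Matrix (Fin dA₁ × Fin dB₁) (Fin dA₁ × Fin dB₁) ℂ)
    (τBC : Matrix (Fin dB₂ × Fin dC₁) (Fin dB₂ × Fin dC₁) ℂ)
    (τCA : Matrix (Fin dC₂ × Fin dA₂) (Fin dC₂ × Fin dA₂) ℂ)
    (hAB : τAB.PosSemidef) (hABtr : τAB.trace = 1)
    (hBC : τBC.PosSemidef) (hBCtr : τBC.trace = 1)
    (hCA : τCA.PosSemidef) (hCAtr : τCA.trace = 1)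
    (MA : Λ → Fin 2 → ℤ → Matrix (Fin dA₁ × Fin dA₂) (Fin dA₁ × Fin dA₂) ℂ)
    (MB : Λ → Fin 3 → ℤ → Matrix (Fin dB₁ × Fin dB₂) (Fin dB₁ × Fin dB₂) ℂ)
    (MC : Λ → Fin 2 → ℤ → Matrix (Fin dC₁ × Fin dC₂) (Fin dC₁ × Fin dC₂) ℂ)
    (hMA : ∀ l x a, a ∈ pm → (MA l x a).PosSemidef)
    (hMAsum : ∀ l x, MA l x (-1) + MA l x 1 = 1)
    (hMB : ∀ l y b, b ∈ pm → (MB l y b).PosSemidef)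
    (hMBsum : ∀ l y, MB l y (-1) + MB l y 1 = 1)
    (hMC : ∀ l z c, c ∈ pm → (MC l z c).PosSemidef)
    (hMCsum : ∀ l z, MC l z (-1) + MC l z 1 = 1)
    (P : ℤ → ℤ → ℤ → Fin 2 → Fin 3 → Fin 2 → ℝ)
    (hP : ∀ a b c x y z,
      P a b c x y z = ∑ l, q l *
        ((((τAB ⊗ₖ τBC ⊗ₖ τCA).submatrix triReindex triReindex *
            (MA l x a ⊗ₖ MB l y b ⊗ₖ MC l z c)).trace).re))
    (hC₁mean : ∀ (x : Fin 2) (y : Fin 3),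
        ∑ a ∈ pm, ∑ b ∈ pm, ∑ c ∈ pm, (c : ℝ) * P a b c x y 1 = 0)
    (hC₁pos : ∀ (x : Fin 2) (y : Fin 3),
        0 < ∑ a ∈ pm, ∑ b ∈ pm, P a b 1 x y 1) :
    condCorr P 0 0 + condCorr P 0 1 + condCorr P 1 0 - condCorr P 1 1
      + 4 * Isame P ≤ 10 := by
  let T (l : Λ) (a b c : ℤ) (x : Fin 2) (y : Fin 3) (z : Fin 2) : ℂ :=
    triangleTrace τAB τBC τCA (MA l x a) (MB l y b) (MC l z c)
  let p (l : Λ) (a b c : ℤ) (x : Fin 2) (y : Fin 3) (z : Fin 2) : ℝ := (T l a b c x y z).re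
  have hPp (a b c x y z) : P a b c x y z = ∑ l, q l * p l a b c x y z := hP a b c x y z
  have hTA (l b c x y z) : T l (-1) b c x y z + T l 1 b c x y z =
      triangleTrace τAB τBC τCA 1 (MB l y b) (MC l z c) := by
    rw [← hMAsum l x, triangleTrace_add_left]
  have hTB (l a c x y z) : T l a (-1) c x y z + T l a 1 c x y z =
      triangleTrace τAB τBC τCA (MA l x a) 1 (MC l z c) := by
    rw [← hMBsum l y, triangleTrace_add_mid]
  have hTC (l a b x y z) : T l a b (-1) x y z + T l a b 1 x y z =
      triangleTrace τAB τBC τCA (MA l x a) (MB l y b) 1 := by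
    rw [← hMCsum l z, triangleTrace_add_right]
  have hTBC (l a x y z) : T l a (-1) (-1) x y z + T l a (-1) 1 x y z +
      (T l a 1 (-1) x y z + T l a 1 1 x y z) = triangleTrace τAB τBC τCA (MA l x a) 1 1 := by
    rw [hTC, hTC, ← triangleTrace_add_mid, hMBsum]
  have hTAB (l c x y z) : T l (-1) (-1) c x y z + T l (-1) 1 c x y z +
      (T l 1 (-1) c x y z + T l 1 1 c x y z) = triangleTrace τAB τBC τCA 1 1 (MC l z c) := by
    rw [hTB, hTB, ← triangleTrace_add_left, hMAsum]
  have hpone (l x y z) : ∑ a ∈ pm, ∑ b ∈ pm, ∑ c ∈ pm, p l a b c x y z = 1 := by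
    have h : ∑ a ∈ pm, ∑ b ∈ pm, ∑ c ∈ pm, T l a b c x y z = 1 := by
      simp only [sum_pm]
      rw [hTBC, hTBC, ← triangleTrace_add_left, hMAsum, triangleTrace_one hABtr hBCtr hCAtr]
    simpa [sum_pm, p] using congrArg Complex.re h
  have hp (l) : ∀ a ∈ pm, ∀ b ∈ pm, ∀ c ∈ pm, ∀ x y z, 0 ≤ p l a b c x y z :=
    fun a ha b hb c hc x y z => (Complex.nonneg_iff.mp (triangleTrace_nonneg hAB hBC hCA
      (hMA l x a ha) (hMB l y b hb) (hMC l z c hc))).1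
  have hA (l) : ∀ b c x x' y z, p l (-1) b c x y z + p l 1 b c x y z =
      p l (-1) b c x' y z + p l 1 b c x' y z := fun b c x x' y z => by
    simpa [p] using congrArg Complex.re ((hTA l b c x y z).trans (hTA l b c x' y z).symm)
  have hB (l) : ∀ a c x y y' z, p l a (-1) c x y z + p l a 1 c x y z =
      p l a (-1) c x y' z + p l a 1 c x y' z := fun a c x y y' z => by
    simpa [p] using congrArg Complex.re ((hTB l a c x y z).trans (hTB l a c x y' z).symm)
  have hC (l) : ∀ a b x y z z', p l a b (-1) x y z + p l a b 1 x y z =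
      p l a b (-1) x y z' + p l a b 1 x y z' := fun a b x y z z' => by
    simpa [p] using congrArg Complex.re ((hTC l a b x y z).trans (hTC l a b x y z').symm)
  let σ := ptraceRight τCA ⊗ₖ ptraceLeft τCA
  have hL : ptraceLeft σ = ptraceLeft τCA := ptraceLeft_marginals hCAtr
  have hR : ptraceRight σ = ptraceRight τCA := ptraceRight_marginals hCAtr
  have hσ : σ.PosSemidef := hCA.ptraceRight.kronecker hCA.ptraceLeft
  have hbound (l) := by
    refine bell_same_bound (p l)
      (fun a b c => (triangleTrace τAB τBC σ (MA l 0 a) (MB l 2 b) (MC l 0 c)).re)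
      (hp l) ?_ (hA l) (hB l) (hC l) (hpone l 0 2 0) ?_ ?_ ?_
    · exact fun a ha b hb c hc => (Complex.nonneg_iff.mp (triangleTrace_nonneg hAB hBC hσ
        (hMA l 0 a ha) (hMB l 2 b hb) (hMC l 0 c hc))).1
    · intro a b
      simp only [sum_pm, p, ← Complex.add_re]
      rw [hTC, ← triangleTrace_add_right, hMCsum, triangleTrace_one_right_congr hL]
    · intro b c
      simp only [sum_pm, p, ← Complex.add_re]
      rw [hTA, ← triangleTrace_add_left, hMAsum, triangleTrace_one_left_congr hR]
    · intro a ha c hc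
      have him : (triangleTrace τAB τBC τCA (MA l 0 a) 1 1).im = 0 :=
        (Complex.nonneg_iff.mp (triangleTrace_nonneg hAB hBC hCA (hMA l 0 a ha)
          Matrix.PosSemidef.one Matrix.PosSemidef.one)).2.symm
      simp only [sum_pm, p, ← Complex.add_re]
      rw [hTBC, hTAB, ← triangleTrace_add_mid, hMBsum, triangleTrace_cut hABtr hBCtr hCAtr,
        Complex.mul_re, him, zero_mul, sub_zero]
  have hPone (x y z) : ∑ a ∈ pm, ∑ b ∈ pm, ∑ c ∈ pm, P a b c x y z = 1 := by
    have h : ∑ a ∈ pm, ∑ b ∈ pm, ∑ c ∈ pm, P a b c x y z =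
        ∑ l, q l * ∑ a ∈ pm, ∑ b ∈ pm, ∑ c ∈ pm, p l a b c x y z := by
      simp only [hPp, sum_pm, ← Finset.sum_add_distrib, mul_add]
    rw [h]
    simpa only [hpone, mul_one] using hq1
  have hhalf (x y) : ∑ a ∈ pm, ∑ b ∈ pm, P a b 1 x y 1 = 1 / 2 := by
    have h1 := hPone x y 1
    have h2 := hC₁mean x y
    simp only [sum_pm] at h1 h2 ⊢
    push_cast at h2
    linarith
  calc condCorr P 0 0 + condCorr P 0 1 + condCorr P 1 0 - condCorr P 1 1 + 4 * Isame P
      = ∑ l, q l * (2 * ((∑ a ∈ pm, ∑ b ∈ pm, (a : ℝ) * b * p l a b 1 0 0 1)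
          + (∑ a ∈ pm, ∑ b ∈ pm, (a : ℝ) * b * p l a b 1 0 1 1)
          + (∑ a ∈ pm, ∑ b ∈ pm, (a : ℝ) * b * p l a b 1 1 0 1)
          - (∑ a ∈ pm, ∑ b ∈ pm, (a : ℝ) * b * p l a b 1 1 1 1)) + 4 * Isame (p l)) := by
        simp only [condCorr, hhalf]
        simp only [Isame, div_eq_mul_inv, hPp, sum_pm, Finset.mul_sum,
          Finset.sum_mul, ← Finset.sum_add_distrib, ← Finset.sum_sub_distrib]
        exact Finset.sum_congr rfl fun l _ => by ring
    _ ≤ ∑ l, q l * (4 * (∑ a ∈ pm, ∑ b ∈ pm, p l a b 1 0 0 1) + 8) :=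
        Finset.sum_le_sum fun l _ => mul_le_mul_of_nonneg_left (hbound l) (hq0 l)
    _ = 4 * (∑ a ∈ pm, ∑ b ∈ pm, P a b 1 0 0 1) + 8 * ∑ l, q l := by
        simp only [hPp, sum_pm, Finset.mul_sum, ← Finset.sum_add_distrib]
        exact Finset.sum_congr rfl fun l _ => by ring
    _ = 10 := by rw [hhalf, hq1]; norm_num
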